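/- Let (X,T) be a TDS, μ ∈ M_T(X), U a cover of X and β a partition of X. Then for every M ∈ ℕ, h^-_μ(U|β,T) = (1/M) h^-_μ(U_0^{M-1} | β_0^{M-1}, T^M), and moreover h^-_μ(U|β,T) = lim_{M→∞} (1/M) h^+_μ(U_0^{M-1} | β_0^{M-1}, T^M). -/

import Mathlib

open MeasureTheory Real Filter

namespace Paper

variable {X : Type*} [MeasurableSpace X]

/-- `𝒰` is a finite cover of `X` (a finite family of sets whose union is `X`). -/
def IsCover (𝒰 : Finset (Set X)) : Prop :=
  ⋃₀ (𝒰 : Set (Set X)) = Set.univ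

/-- `𝒰` is a partition of `X`: a cover by pairwise disjoint sets. -/
def IsPartition (𝒰 : Finset (Set X)) : Prop :=
  IsCover 𝒰 ∧ ∀ A ∈ 𝒰, ∀ B ∈ 𝒰, A ≠ B → Disjoint A B

/-- All members of `𝒰` are measurable (Borel) sets. -/
def MeasF (𝒰 : Finset (Set X)) : Prop := ∀ A ∈ 𝒰, MeasurableSet A

/-- `𝒰 ≽ 𝒱` : every element of `𝒰` is contained in some element of `𝒱`. -/
def Refines (𝒰 𝒱 : Finset (Set X)) : Prop := ∀ A ∈ 𝒰, ∃ B ∈ 𝒱, A ⊆ B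

/-- The join `𝒰 ∨ 𝒱 = {U ∩ V : U ∈ 𝒰, V ∈ 𝒱}`. -/
noncomputable def join (𝒰 𝒱 : Finset (Set X)) : Finset (Set X) :=
  letI := Classical.decEq (Set X)
  (𝒰 ×ˢ 𝒱).image fun p => p.1 ∩ p.2

/-- The preimage cover `f⁻¹𝒰 = {f⁻¹U : U ∈ 𝒰}`. -/
noncomputable def pre {Y : Type*} (f : X → Y) (𝒰 : Finset (Set Y)) : Finset (Set X) :=
  letI := Classical.decEq (Set X)
  𝒰.image fun U => f ⁻¹' U

/-- `dynJoin f 𝒰 N = 𝒰_0^{N-1} = ⋁_{n=0}^{N-1} f^{-n} 𝒰` (equal to `{univ}` for `N = 0`). -/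
noncomputable def dynJoin (f : X → X) (𝒰 : Finset (Set X)) : ℕ → Finset (Set X)
  | 0 => {Set.univ}
  | (N + 1) => join (dynJoin f 𝒰 N) (pre (f^[N]) 𝒰)

/-- `N(𝒰 ∩ B)`: the minimal cardinality of a subfamily of `𝒰` whose union contains `B`. -/
noncomputable def covNum (𝒰 : Finset (Set X)) (B : Set X) : ℕ :=
  sInf {k : ℕ | ∃ 𝒱 ⊆ 𝒰, 𝒱.card = k ∧ B ⊆ ⋃₀ (𝒱 : Set (Set X))}

/-- `N(𝒰|β) = max_{B ∈ β} N(𝒰 ∩ B)`. -/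
noncomputable def covNumCond (𝒰 β : Finset (Set X)) : ℕ :=
  β.sup fun B => covNum 𝒰 B

/-- The entropy `H_μ(α) = -∑_{A ∈ α} μ(A) log μ(A)` of a finite family of sets. -/
noncomputable def entPart (μ : Measure X) (α : Finset (Set X)) : ℝ :=
  ∑ A ∈ α, negMulLog (μ A).toReal

/-- Conditional entropy `H_μ(α|β) = ∑_{B ∈ β} μ(B) H_{μ_B}(α)`, where `μ_B` is the
conditional measure (which is `0` when `μ(B) = 0`). -/
noncomputable def entCondPart (μ : Measure X) (α β : Finset (Set X)) : ℝ :=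
  ∑ B ∈ β, (μ B).toReal * entPart (ProbabilityTheory.cond μ B) α

/-- `H_μ(𝒰) = inf { H_μ(α) : α a measurable partition finer than 𝒰 }`. -/
noncomputable def covEnt (μ : Measure X) (𝒰 : Finset (Set X)) : ℝ :=
  sInf {h : ℝ | ∃ α : Finset (Set X),
    IsPartition α ∧ MeasF α ∧ Refines α 𝒰 ∧ h = entPart μ α}

/-- `H_μ(𝒰|β) = ∑_{B ∈ β} μ(B) H_{μ_B}(𝒰)` for a cover `𝒰` and a partition `β`. -/
noncomputable def covEntCond (μ : Measure X) (𝒰 β : Finset (Set X)) : ℝ :=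
  ∑ B ∈ β, (μ B).toReal * covEnt (ProbabilityTheory.cond μ B) 𝒰

/-- `h_μ(α|β,f) = lim_N (1/N) H_μ(α_0^{N-1}|β_0^{N-1})`; by subadditivity the limit
equals the infimum. -/
noncomputable def hPart (f : X → X) (μ : Measure X) (α β : Finset (Set X)) : ℝ :=
  ⨅ N : ℕ, entCondPart μ (dynJoin f α (N + 1)) (dynJoin f β (N + 1)) / (N + 1 : ℝ)

/-- `h_μ^-(𝒰|β,f) = lim_N (1/N) H_μ(𝒰_0^{N-1}|β_0^{N-1})`; by subadditivity the limit
equals the infimum. -/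
noncomputable def hMinus (f : X → X) (μ : Measure X) (𝒰 β : Finset (Set X)) : ℝ :=
  ⨅ N : ℕ, covEntCond μ (dynJoin f 𝒰 (N + 1)) (dynJoin f β (N + 1)) / (N + 1 : ℝ)

/-- `h_μ^+(𝒰|β,f) = inf { h_μ(α|β,f) : α a measurable partition finer than 𝒰 }`. -/
noncomputable def hPlus (f : X → X) (μ : Measure X) (𝒰 β : Finset (Set X)) : ℝ :=
  sInf {h : ℝ | ∃ α : Finset (Set X),
    IsPartition α ∧ MeasF α ∧ Refines α 𝒰 ∧ h = hPart f μ α β}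

/-- The (combinatorial/topological) conditional entropy
`h(𝒰|β,f) = lim_N (1/N) log N(𝒰_0^{N-1}|β_0^{N-1})`; by subadditivity the limit
equals the infimum. -/
noncomputable def hTop (f : X → X) (𝒰 β : Finset (Set X)) : ℝ :=
  ⨅ N : ℕ, Real.log (covNumCond (dynJoin f 𝒰 (N + 1)) (dynJoin f β (N + 1))) / (N + 1 : ℝ)

/-- The finite family of sets associated to an indexed cover `{U_1, …, U_M}`. -/
noncomputable def rangeFinset {M : ℕ} (U : Fin M → Set X) : Finset (Set X) :=
  letI := Classical.decEq (Set X)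
  Finset.image U Finset.univ

end Paper

namespace Paper

variable {X : Type*}

/-! ### Joins and preimages of finite families -/

lemma mem_join {𝒰 𝒱 : Finset (Set X)} {A : Set X} :
    A ∈ join 𝒰 𝒱 ↔ ∃ U ∈ 𝒰, ∃ V ∈ 𝒱, U ∩ V = A := by
  simp [join, and_assoc]

lemma mem_pre {Y : Type*} {f : X → Y} {𝒰 : Finset (Set Y)} {A : Set X} :
    A ∈ pre f 𝒰 ↔ ∃ U ∈ 𝒰, f ⁻¹' U = A := by
  simp [pre]

lemma join_comm (𝒰 𝒱 : Finset (Set X)) : join 𝒰 𝒱 = join 𝒱 𝒰 := by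
  ext A
  simp only [mem_join]
  constructor
  all_goals
    rintro ⟨U, hU, V, hV, rfl⟩
    exact ⟨V, hV, U, hU, Set.inter_comm _ _⟩

lemma join_assoc (𝒰 𝒱 𝒲 : Finset (Set X)) : join (join 𝒰 𝒱) 𝒲 = join 𝒰 (join 𝒱 𝒲) := by
  ext A
  simp only [mem_join]
  constructor
  · rintro ⟨_, ⟨U, hU, V, hV, rfl⟩, W, hW, rfl⟩
    exact ⟨U, hU, _, ⟨V, hV, W, hW, rfl⟩, (Set.inter_assoc _ _ _).symm⟩
  · rintro ⟨U, hU, _, ⟨V, hV, W, hW, rfl⟩, rfl⟩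
    exact ⟨_, ⟨U, hU, V, hV, rfl⟩, W, hW, Set.inter_assoc _ _ _⟩

lemma join_univ (𝒰 : Finset (Set X)) : join 𝒰 {Set.univ} = 𝒰 := by
  ext A
  simp [mem_join]

lemma univ_join (𝒰 : Finset (Set X)) : join {Set.univ} 𝒰 = 𝒰 := by
  rw [join_comm, join_univ]

lemma pre_id (𝒰 : Finset (Set X)) : pre id 𝒰 = 𝒰 := by
  ext A
  simp [mem_pre]

lemma pre_join (f : X → X) (𝒰 𝒱 : Finset (Set X)) :
    pre f (join 𝒰 𝒱) = join (pre f 𝒰) (pre f 𝒱) := by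
  ext A
  simp only [mem_join, mem_pre]
  constructor
  · rintro ⟨_, ⟨U, hU, V, hV, rfl⟩, rfl⟩
    exact ⟨_, ⟨U, hU, rfl⟩, _, ⟨V, hV, rfl⟩, rfl⟩
  · rintro ⟨_, ⟨U, hU, rfl⟩, _, ⟨V, hV, rfl⟩, rfl⟩
    exact ⟨_, ⟨U, hU, V, hV, rfl⟩, rfl⟩

lemma pre_univ (f : X → X) : pre f {Set.univ} = {Set.univ} := by
  ext A
  simp [mem_pre, eq_comm]

lemma pre_pre (f g : X → X) (𝒰 : Finset (Set X)) : pre f (pre g 𝒰) = pre (g ∘ f) 𝒰 := by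
  ext A
  simp [mem_pre, Set.preimage_comp]

lemma dynJoin_one (f : X → X) (𝒰 : Finset (Set X)) : dynJoin f 𝒰 1 = 𝒰 := by
  simp only [dynJoin, Function.iterate_zero, pre_id, univ_join]

lemma dynJoin_add (f : X → X) (𝒰 : Finset (Set X)) (m n : ℕ) :
    dynJoin f 𝒰 (m + n) = join (dynJoin f 𝒰 m) (pre f^[m] (dynJoin f 𝒰 n)) := by
  induction n with
  | zero => simp only [add_zero, dynJoin, pre_univ, join_univ]
  | succ n ih =>
    rw [← add_assoc]
    simp only [dynJoin]
    rw [ih, join_assoc, pre_join, pre_pre, ← Function.iterate_add, add_comm n m]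

lemma dynJoin_iterate (f : X → X) (𝒰 : Finset (Set X)) (m n : ℕ) :
    dynJoin f^[m] (dynJoin f 𝒰 m) n = dynJoin f 𝒰 (m * n) := by
  induction n with
  | zero => rfl
  | succ n ih =>
    rw [Nat.mul_succ, dynJoin_add f 𝒰, ← ih, Function.iterate_mul]
    rfl

lemma Refines.join {𝒰 𝒰' 𝒱 𝒱' : Finset (Set X)} (h : Refines 𝒰 𝒰') (h' : Refines 𝒱 𝒱') :
    Refines (join 𝒰 𝒱) (Paper.join 𝒰' 𝒱') := by
  intro A hA
  obtain ⟨U, hU, V, hV, rfl⟩ := mem_join.1 hA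
  obtain ⟨U', hU', hUU'⟩ := h U hU
  obtain ⟨V', hV', hVV'⟩ := h' V hV
  exact ⟨U' ∩ V', mem_join.2 ⟨U', hU', V', hV', rfl⟩, Set.inter_subset_inter hUU' hVV'⟩

lemma Refines.pre {𝒰 𝒱 : Finset (Set X)} (h : Refines 𝒰 𝒱) (f : X → X) :
    Refines (pre f 𝒰) (Paper.pre f 𝒱) := by
  intro A hA
  obtain ⟨U, hU, rfl⟩ := mem_pre.1 hA
  obtain ⟨V, hV, hUV⟩ := h U hU
  exact ⟨f ⁻¹' V, mem_pre.2 ⟨V, hV, rfl⟩, Set.preimage_mono hUV⟩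

lemma Refines.dynJoin {𝒰 𝒱 : Finset (Set X)} (h : Refines 𝒰 𝒱) (f : X → X) (n : ℕ) :
    Refines (dynJoin f 𝒰 n) (Paper.dynJoin f 𝒱 n) := by
  induction n with
  | zero => exact fun A hA => ⟨A, hA, le_rfl⟩
  | succ n ih => exact ih.join (h.pre _)

lemma isCover_iff {𝒰 : Finset (Set X)} : IsCover 𝒰 ↔ ∀ x, ∃ U ∈ 𝒰, x ∈ U := by
  simp [IsCover, Set.sUnion_eq_univ_iff]

lemma IsCover.join {𝒰 𝒱 : Finset (Set X)} (h : IsCover 𝒰) (h' : IsCover 𝒱) :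
    IsCover (join 𝒰 𝒱) := by
  rw [isCover_iff] at *
  intro x
  obtain ⟨U, hU, hxU⟩ := h x
  obtain ⟨V, hV, hxV⟩ := h' x
  exact ⟨U ∩ V, mem_join.2 ⟨U, hU, V, hV, rfl⟩, hxU, hxV⟩

lemma IsCover.pre {𝒰 : Finset (Set X)} (h : IsCover 𝒰) (f : X → X) : IsCover (pre f 𝒰) := by
  rw [isCover_iff] at *
  intro x
  obtain ⟨U, hU, hxU⟩ := h (f x)
  exact ⟨f ⁻¹' U, mem_pre.2 ⟨U, hU, rfl⟩, hxU⟩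

lemma IsCover.dynJoin {𝒰 : Finset (Set X)} (h : IsCover 𝒰) (f : X → X) (n : ℕ) :
    IsCover (dynJoin f 𝒰 n) := by
  induction n with
  | zero => simp [IsCover, Paper.dynJoin]
  | succ n ih => exact ih.join (h.pre _)

lemma IsPartition.join {α β : Finset (Set X)} (h : IsPartition α) (h' : IsPartition β) :
    IsPartition (join α β) := by
  refine ⟨h.1.join h'.1, fun A hA B hB hAB => ?_⟩
  obtain ⟨U, hU, V, hV, rfl⟩ := mem_join.1 hA
  obtain ⟨U', hU', V', hV', rfl⟩ := mem_join.1 hB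
  by_cases hUU' : U = U'
  · have hVV' : V ≠ V' := fun hVV' => hAB (by rw [hUU', hVV'])
    exact (h'.2 V hV V' hV' hVV').mono Set.inter_subset_right Set.inter_subset_right
  · exact (h.2 U hU U' hU' hUU').mono Set.inter_subset_left Set.inter_subset_left

lemma IsPartition.pre {α : Finset (Set X)} (h : IsPartition α) (f : X → X) :
    IsPartition (pre f α) := by
  refine ⟨h.1.pre f, fun A hA B hB hAB => ?_⟩
  obtain ⟨U, hU, rfl⟩ := mem_pre.1 hA
  obtain ⟨V, hV, rfl⟩ := mem_pre.1 hB
  exact (h.2 U hU V hV fun hUV => hAB (by rw [hUV])).preimage f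

lemma IsPartition.dynJoin {α : Finset (Set X)} (h : IsPartition α) (f : X → X) (n : ℕ) :
    IsPartition (dynJoin f α n) := by
  induction n with
  | zero =>
    refine ⟨by simp [IsCover, Paper.dynJoin], fun A hA B hB hAB => absurd ?_ hAB⟩
    rw [Finset.mem_singleton.1 hA, Finset.mem_singleton.1 hB]
  | succ n ih => exact ih.join (h.pre _)

lemma sum_join {α β : Finset (Set X)} (hα : IsPartition α) (hβ : IsPartition β)
    (F : Set X → ℝ) (hF : F ∅ = 0) :
    ∑ D ∈ join α β, F D = ∑ A ∈ α, ∑ B ∈ β, F (A ∩ B) := by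
  rw [← Finset.sum_product', join]
  refine Finset.sum_image_of_pairwise_eq_zero fun p hp q hq hpq heq => ?_
  simp only [Finset.coe_product, Set.mem_prod, Finset.mem_coe] at hp hq
  have hdisj : Disjoint (p.1 ∩ p.2) (q.1 ∩ q.2) := by
    by_cases h1 : p.1 = q.1
    · have h2 : p.2 ≠ q.2 := fun h2 => hpq (Prod.ext h1 h2)
      exact (hβ.2 _ hp.2 _ hq.2 h2).mono Set.inter_subset_right Set.inter_subset_right
    · exact (hα.2 _ hp.1 _ hq.1 h1).mono Set.inter_subset_left Set.inter_subset_left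
  rw [← heq, disjoint_self] at hdisj
  rw [hdisj]
  exact hF

variable [MeasurableSpace X]

lemma MeasF.join {𝒰 𝒱 : Finset (Set X)} (h : MeasF 𝒰) (h' : MeasF 𝒱) : MeasF (join 𝒰 𝒱) := by
  intro A hA
  obtain ⟨U, hU, V, hV, rfl⟩ := mem_join.1 hA
  exact (h U hU).inter (h' V hV)

lemma MeasF.pre {𝒰 : Finset (Set X)} (h : MeasF 𝒰) {f : X → X} (hf : Measurable f) :
    MeasF (pre f 𝒰) := by
  intro A hA
  obtain ⟨U, hU, rfl⟩ := mem_pre.1 hA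
  exact hf (h U hU)

lemma MeasF.dynJoin {𝒰 : Finset (Set X)} (h : MeasF 𝒰) {f : X → X} (hf : Measurable f) (n : ℕ) :
    MeasF (dynJoin f 𝒰 n) := by
  induction n with
  | zero => exact fun A hA => by rw [Finset.mem_singleton.1 hA]; exact .univ
  | succ n ih => exact ih.join (h.pre (hf.iterate n))

lemma exists_disjoint_refinement (𝒰 : Finset (Set X)) (h𝒰 : MeasF 𝒰) :
    ∃ α : Finset (Set X), ⋃₀ (α : Set (Set X)) = ⋃₀ (𝒰 : Set (Set X)) ∧
      (∀ A ∈ α, ∀ B ∈ α, A ≠ B → Disjoint A B) ∧ MeasF α ∧ Refines α 𝒰 := by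
  classical
  induction 𝒰 using Finset.induction_on with
  | empty => exact ⟨∅, rfl, by simp, by simp [MeasF], by simp [Refines]⟩
  | insert U 𝒰 hU ih =>
    have h𝒰' : MeasF 𝒰 := fun A hA => h𝒰 A (Finset.mem_insert_of_mem hA)
    obtain ⟨α, hαU, hdisj, hm, href⟩ := ih h𝒰'
    have hsub : ∀ A ∈ α, Disjoint (U \ ⋃₀ (𝒰 : Set (Set X))) A := fun A hA =>
      Set.disjoint_sdiff_left.mono_right (hαU ▸ Set.subset_sUnion_of_mem (Finset.mem_coe.2 hA))
    refine ⟨insert (U \ ⋃₀ (𝒰 : Set (Set X))) α, ?_, ?_, ?_, ?_⟩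
    · simp only [Finset.coe_insert, Set.sUnion_insert, hαU, Set.sdiff_union_self]
    · intro A hA B hB hAB
      rcases Finset.mem_insert.1 hA with rfl | hA <;> rcases Finset.mem_insert.1 hB with rfl | hB
      · exact absurd rfl hAB
      · exact hsub B hB
      · exact (hsub A hA).symm
      · exact hdisj A hA B hB hAB
    · intro A hA
      rcases Finset.mem_insert.1 hA with rfl | hA
      · exact (h𝒰 U (Finset.mem_insert_self _ _)).diff
          (.sUnion 𝒰.countable_toSet fun A hA => h𝒰' A hA)
      · exact hm A hA
    · intro A hA
      rcases Finset.mem_insert.1 hA with rfl | hA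
      · exact ⟨U, Finset.mem_insert_self _ _, Set.sdiff_subset⟩
      · obtain ⟨B, hB, hAB⟩ := href A hA
        exact ⟨B, Finset.mem_insert_of_mem hB, hAB⟩

lemma exists_partition_refines {𝒰 : Finset (Set X)} (hc : IsCover 𝒰) (hm : MeasF 𝒰) :
    ∃ α : Finset (Set X), IsPartition α ∧ MeasF α ∧ Refines α 𝒰 := by
  obtain ⟨α, h1, h2, h3, h4⟩ := exists_disjoint_refinement 𝒰 hm
  exact ⟨α, ⟨h1.trans hc, h2⟩, h3, h4⟩

/-! ### Entropy of partitions -/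

lemma sum_real_inter (μ : Measure X) [IsFiniteMeasure μ] {γ : Finset (Set X)}
    (hγ : IsPartition γ) (hγm : MeasF γ) (B : Set X) :
    ∑ C ∈ γ, μ.real (B ∩ C) = μ.real B := by
  have hdisj : (γ : Set (Set X)).PairwiseDisjoint id := fun A hA B hB hAB => hγ.2 A hA B hB hAB
  have h := measureReal_biUnion_finset (μ := μ.restrict B) (s := γ) (f := id) hdisj hγm
  have hc : (⋃ C ∈ γ, id C) = Set.univ := by
    rw [← hγ.1, Set.sUnion_eq_biUnion]
    rfl
  rw [hc, measureReal_restrict_apply .univ, Set.univ_inter] at h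
  rw [h]
  refine Finset.sum_congr rfl fun C hC => ?_
  rw [id, measureReal_restrict_apply (hγm C hC), Set.inter_comm]

lemma entPart_cond (μ : Measure X) {B : Set X} (hB : MeasurableSet B) (α : Finset (Set X)) :
    entPart (ProbabilityTheory.cond μ B) α =
      ∑ A ∈ α, negMulLog (μ.real (B ∩ A) / μ.real B) := by
  refine Finset.sum_congr rfl fun A _ => ?_
  rw [ProbabilityTheory.cond_apply hB, ENNReal.toReal_mul, ENNReal.toReal_inv, div_eq_inv_mul]
  rfl

lemma entCondPart_eq (μ : Measure X) {β : Finset (Set X)} (hβ : MeasF β) (α : Finset (Set X)) :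
    entCondPart μ α β =
      ∑ B ∈ β, ∑ A ∈ α, μ.real B * negMulLog (μ.real (B ∩ A) / μ.real B) := by
  refine Finset.sum_congr rfl fun B hB => ?_
  rw [entPart_cond μ (hβ B hB), Finset.mul_sum]
  rfl

lemma sum_mul_negMulLog_le (μ : Measure X) [IsFiniteMeasure μ] {γ : Finset (Set X)}
    (hγ : IsPartition γ) (hγm : MeasF γ) (A B : Set X) :
    ∑ C ∈ γ, μ.real (B ∩ C) * negMulLog (μ.real (B ∩ C ∩ A) / μ.real (B ∩ C)) ≤
      μ.real B * negMulLog (μ.real (B ∩ A) / μ.real B) := by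
  have hle (S R : Set X) : μ.real (S ∩ R) ≤ μ.real S := measureReal_mono Set.inter_subset_left
  rcases eq_or_lt_of_le (measureReal_nonneg (μ := μ) (s := B)) with h0 | hpos
  · have hz (C : Set X) : μ.real (B ∩ C) = 0 :=
      le_antisymm ((hle B C).trans h0.symm.le) measureReal_nonneg
    simp [hz]
  · have hw : ∑ C ∈ γ, μ.real (B ∩ C) / μ.real B = 1 := by
      rw [← Finset.sum_div, sum_real_inter μ hγ hγm, div_self hpos.ne']
    have hJ := concaveOn_negMulLog.le_map_sum (t := γ)
      (w := fun C => μ.real (B ∩ C) / μ.real B)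
      (p := fun C => μ.real (B ∩ C ∩ A) / μ.real (B ∩ C))
      (fun C _ => by positivity) hw (fun C _ => by simp only [Set.mem_Ici]; positivity)
    have hp : ∑ C ∈ γ, (μ.real (B ∩ C) / μ.real B) • (μ.real (B ∩ C ∩ A) / μ.real (B ∩ C)) =
        μ.real (B ∩ A) / μ.real B := by
      rw [← sum_real_inter μ hγ hγm (B ∩ A), Finset.sum_div]
      refine Finset.sum_congr rfl fun C _ => ?_
      rw [Set.inter_right_comm B A C, smul_eq_mul]
      rcases eq_or_ne (μ.real (B ∩ C)) 0 with h | h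
      · have : μ.real (B ∩ C ∩ A) = 0 := le_antisymm ((hle _ _).trans h.le) measureReal_nonneg
        simp [h, this]
      · field_simp
    rw [hp] at hJ
    calc _ = μ.real B * ∑ C ∈ γ, (μ.real (B ∩ C) / μ.real B) •
          negMulLog (μ.real (B ∩ C ∩ A) / μ.real (B ∩ C)) := by
          rw [Finset.mul_sum]
          refine Finset.sum_congr rfl fun C _ => ?_
          rw [smul_eq_mul, ← mul_assoc, mul_div_cancel₀ _ hpos.ne']
      _ ≤ _ := by gcongr

lemma entCondPart_join_right_le (μ : Measure X) [IsFiniteMeasure μ] {β γ : Finset (Set X)}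
    (hβ : IsPartition β) (hβm : MeasF β) (hγ : IsPartition γ) (hγm : MeasF γ)
    (α : Finset (Set X)) :
    entCondPart μ α (join β γ) ≤ entCondPart μ α β := by
  rw [entCondPart_eq μ (hβm.join hγm), entCondPart_eq μ hβm, sum_join hβ hγ _ (by simp)]
  refine Finset.sum_le_sum fun B _ => ?_
  rw [Finset.sum_comm]
  exact Finset.sum_le_sum fun A _ => sum_mul_negMulLog_le μ hγ hγm A B

lemma entPart_join_le (μ : Measure X) [IsProbabilityMeasure μ] {α γ : Finset (Set X)}
    (hα : IsPartition α) (hαm : MeasF α) (hγ : IsPartition γ) (hγm : MeasF γ) :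
    entPart μ (join α γ) ≤ entPart μ α + entPart μ γ := by
  have hchain : ∀ C ∈ γ, ∑ A ∈ α, negMulLog (μ.real (C ∩ A)) =
      negMulLog (μ.real C) +
        ∑ A ∈ α, μ.real C * negMulLog (μ.real (C ∩ A) / μ.real C) := by
    intro C _
    rcases eq_or_ne (μ.real C) 0 with h | h
    · have hz (A : Set X) : μ.real (C ∩ A) = 0 :=
        le_antisymm ((measureReal_mono Set.inter_subset_left).trans h.le) measureReal_nonneg
      simp [h, hz]
    · have hw : ∑ A ∈ α, μ.real (C ∩ A) / μ.real C = 1 := by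
        rw [← Finset.sum_div, sum_real_inter μ hα hαm, div_self h]
      calc _ = ∑ A ∈ α, (μ.real (C ∩ A) / μ.real C * negMulLog (μ.real C) +
            μ.real C * negMulLog (μ.real (C ∩ A) / μ.real C)) := by
            refine Finset.sum_congr rfl fun A _ => ?_
            rw [← negMulLog_mul, mul_div_cancel₀ _ h]
        _ = _ := by rw [Finset.sum_add_distrib, ← Finset.sum_mul, hw, one_mul]
  have hJ (A : Set X) : ∑ C ∈ γ, μ.real C * negMulLog (μ.real (C ∩ A) / μ.real C) ≤
      negMulLog (μ.real A) := by
    simpa using sum_mul_negMulLog_le μ hγ hγm A Set.univ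
  calc entPart μ (join α γ) = ∑ C ∈ γ, ∑ A ∈ α, negMulLog (μ.real (C ∩ A)) := by
        rw [join_comm]
        exact sum_join hγ hα (fun D => negMulLog (μ.real D)) (by simp)
    _ = ∑ C ∈ γ, negMulLog (μ.real C) +
          ∑ A ∈ α, ∑ C ∈ γ, μ.real C * negMulLog (μ.real (C ∩ A) / μ.real C) := by
        rw [Finset.sum_congr rfl hchain, Finset.sum_add_distrib]
        congr 1
        exact Finset.sum_comm
    _ ≤ ∑ C ∈ γ, negMulLog (μ.real C) + ∑ A ∈ α, negMulLog (μ.real A) := by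
        gcongr with A
        exact hJ A
    _ = _ := add_comm _ _

lemma entCondPart_join_left_le (μ : Measure X) [IsFiniteMeasure μ] {α γ : Finset (Set X)}
    (hα : IsPartition α) (hαm : MeasF α) (hγ : IsPartition γ) (hγm : MeasF γ)
    (β : Finset (Set X)) :
    entCondPart μ (join α γ) β ≤ entCondPart μ α β + entCondPart μ γ β := by
  simp only [entCondPart]
  rw [← Finset.sum_add_distrib]
  refine Finset.sum_le_sum fun B _ => ?_
  rcases eq_or_ne (μ B) 0 with h | h
  · simp [h]
  · have := ProbabilityTheory.cond_isProbabilityMeasure h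
    rw [← mul_add]
    gcongr
    exact entPart_join_le _ hα hαm hγ hγm

lemma entCondPart_pre (μ : Measure X) {f : X → X} (hf : MeasurePreserving f μ μ)
    (hs : Function.Surjective f) {α β : Finset (Set X)} (hα : MeasF α) (hβ : MeasF β) :
    entCondPart μ (pre f α) (pre f β) = entCondPart μ α β := by
  have hinj : Function.Injective fun U : Set X => f ⁻¹' U := Set.preimage_injective.2 hs
  have hreal {S : Set X} (hS : MeasurableSet S) : μ.real (f ⁻¹' S) = μ.real S :=
    hf.measureReal_preimage hS.nullMeasurableSet
  have hsum (γ : Finset (Set X)) (F : Set X → ℝ) :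
      ∑ S ∈ pre f γ, F S = ∑ S ∈ γ, F (f ⁻¹' S) := Finset.sum_image hinj.injOn
  rw [entCondPart_eq μ (hβ.pre hf.measurable), entCondPart_eq μ hβ, hsum]
  refine Finset.sum_congr rfl fun B hB => ?_
  rw [hsum]
  refine Finset.sum_congr rfl fun A hA => ?_
  rw [← Set.preimage_inter, hreal (hβ B hB), hreal ((hβ B hB).inter (hα A hA))]

/-! ### Entropy of covers -/

lemma entPart_cond_nonneg (μ : Measure X) (B : Set X) (α : Finset (Set X)) :
    0 ≤ entPart (ProbabilityTheory.cond μ B) α :=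
  Finset.sum_nonneg fun _ _ => negMulLog_nonneg ENNReal.toReal_nonneg
    (ENNReal.toReal_le_of_le_ofReal zero_le_one (by simpa using prob_le_one))

lemma entCondPart_nonneg (μ : Measure X) (α β : Finset (Set X)) : 0 ≤ entCondPart μ α β :=
  Finset.sum_nonneg fun B _ => mul_nonneg ENNReal.toReal_nonneg (entPart_cond_nonneg μ B α)

lemma covEntCond_nonneg (μ : Measure X) (𝒰 β : Finset (Set X)) : 0 ≤ covEntCond μ 𝒰 β := by
  refine Finset.sum_nonneg fun B _ => mul_nonneg ENNReal.toReal_nonneg (Real.sInf_nonneg ?_)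
  rintro _ ⟨α, -, -, -, rfl⟩
  exact entPart_cond_nonneg μ B α

lemma covEntCond_le_entCondPart (μ : Measure X) {𝒰 α : Finset (Set X)} (hα : IsPartition α)
    (hαm : MeasF α) (hα𝒰 : Refines α 𝒰) (β : Finset (Set X)) :
    covEntCond μ 𝒰 β ≤ entCondPart μ α β := by
  refine Finset.sum_le_sum fun B _ => mul_le_mul_of_nonneg_left ?_ ENNReal.toReal_nonneg
  refine csInf_le ⟨0, ?_⟩ ⟨α, hα, hαm, hα𝒰, rfl⟩
  rintro _ ⟨α, -, -, -, rfl⟩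
  exact entPart_cond_nonneg μ B α

/-- The infimum over partitions may be taken independently on each cell of `β`: partitions chosen
on the cells glue to a partition of the whole space. -/
lemma exists_entCondPart_le (μ : Measure X) [IsProbabilityMeasure μ] {𝒰 β : Finset (Set X)}
    (h𝒰 : IsCover 𝒰) (h𝒰m : MeasF 𝒰) (hβ : IsPartition β) (hβm : MeasF β) {ε : ℝ} (hε : 0 < ε) :
    ∃ α : Finset (Set X), IsPartition α ∧ MeasF α ∧ Refines α 𝒰 ∧
      entCondPart μ α β ≤ covEntCond μ 𝒰 β + ε := by
  classical
  have hex (B : Set X) : ∃ α : Finset (Set X), (IsPartition α ∧ MeasF α ∧ Refines α 𝒰) ∧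
      entPart (ProbabilityTheory.cond μ B) α <
        covEnt (ProbabilityTheory.cond μ B) 𝒰 + ε := by
    obtain ⟨α₀, h1, h2, h3⟩ := exists_partition_refines h𝒰 h𝒰m
    obtain ⟨_, ⟨α, h1, h2, h3, rfl⟩, hlt⟩ := exists_lt_of_csInf_lt
      (s := {h : ℝ | ∃ α : Finset (Set X), IsPartition α ∧ MeasF α ∧ Refines α 𝒰 ∧
        h = entPart (ProbabilityTheory.cond μ B) α})
      ⟨_, α₀, h1, h2, h3, rfl⟩ (lt_add_of_pos_right _ hε)
    exact ⟨α, ⟨h1, h2, h3⟩, hlt⟩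
  choose a ha hlt using hex
  set α : Finset (Set X) := β.biUnion fun B => (a B).image (B ∩ ·) with hαdef
  have hmem {S : Set X} : S ∈ α ↔ ∃ B ∈ β, ∃ A ∈ a B, B ∩ A = S := by simp [hαdef]
  refine ⟨α, ⟨?_, ?_⟩, ?_, ?_, ?_⟩
  · rw [isCover_iff]
    intro x
    obtain ⟨B, hB, hxB⟩ := isCover_iff.1 hβ.1 x
    obtain ⟨A, hA, hxA⟩ := isCover_iff.1 (ha B).1.1 x
    exact ⟨B ∩ A, hmem.2 ⟨B, hB, A, hA, rfl⟩, hxB, hxA⟩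
  · intro S hS S' hS' hSS'
    obtain ⟨B, hB, A, hA, rfl⟩ := hmem.1 hS
    obtain ⟨B', hB', A', hA', rfl⟩ := hmem.1 hS'
    by_cases h : B = B'
    · subst h
      have hAA' : A ≠ A' := fun h => hSS' (by rw [h])
      exact ((ha B).1.2 A hA A' hA' hAA').mono Set.inter_subset_right Set.inter_subset_right
    · exact (hβ.2 B hB B' hB' h).mono Set.inter_subset_left Set.inter_subset_left
  · intro S hS
    obtain ⟨B, hB, A, hA, rfl⟩ := hmem.1 hS
    exact (hβm B hB).inter ((ha B).2.1 A hA)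
  · intro S hS
    obtain ⟨B, hB, A, hA, rfl⟩ := hmem.1 hS
    obtain ⟨U, hU, hAU⟩ := (ha B).2.2 A hA
    exact ⟨U, hU, Set.inter_subset_right.trans hAU⟩
  · have hglue : ∀ B ∈ β, entPart (ProbabilityTheory.cond μ B) α =
        entPart (ProbabilityTheory.cond μ B) (a B) := by
      intro B hB
      rw [entPart_cond μ (hβm B hB), entPart_cond μ (hβm B hB)]
      have hsub : (a B).image (B ∩ ·) ⊆ α :=
        Finset.subset_biUnion_of_mem (fun B => (a B).image (B ∩ ·)) hB
      rw [← Finset.sum_subset hsub, Finset.sum_image_of_pairwise_eq_zero]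
      · simp only [← Set.inter_assoc, Set.inter_self]
      · intro A hA A' hA' hAA' heq
        have hd : Disjoint (B ∩ A) (B ∩ A') := ((ha B).1.2 A hA A' hA' hAA').mono
          Set.inter_subset_right Set.inter_subset_right
        rw [← heq, disjoint_self, Set.bot_eq_empty] at hd
        simp [hd]
      · intro S hS hSB
        obtain ⟨B', hB', A, hA, rfl⟩ := hmem.1 hS
        have hne : B ≠ B' := by
          rintro rfl
          exact hSB (Finset.mem_image_of_mem _ hA)
        have hd : B ∩ (B' ∩ A) = ∅ :=
          ((hβ.2 B hB B' hB' hne).mono_right Set.inter_subset_left).inter_eq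
        simp [hd]
    have hone : ∑ B ∈ β, (μ B).toReal = 1 := by
      simpa [Measure.real] using sum_real_inter μ hβ hβm Set.univ
    calc entCondPart μ α β
        ≤ ∑ B ∈ β, (μ B).toReal * (covEnt (ProbabilityTheory.cond μ B) 𝒰 + ε) := by
          refine Finset.sum_le_sum fun B hB => ?_
          rw [hglue B hB]
          exact mul_le_mul_of_nonneg_left (hlt B).le ENNReal.toReal_nonneg
      _ = covEntCond μ 𝒰 β + ε := by
          simp only [mul_add]
          rw [Finset.sum_add_distrib, ← Finset.sum_mul, hone, one_mul]
          rfl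

lemma covEntCond_join_le (μ : Measure X) [IsProbabilityMeasure μ] {𝒰 𝒱 β γ : Finset (Set X)}
    (h𝒰 : IsCover 𝒰) (h𝒰m : MeasF 𝒰) (h𝒱 : IsCover 𝒱) (h𝒱m : MeasF 𝒱)
    (hβ : IsPartition β) (hβm : MeasF β) (hγ : IsPartition γ) (hγm : MeasF γ) :
    covEntCond μ (join 𝒰 𝒱) (join β γ) ≤ covEntCond μ 𝒰 β + covEntCond μ 𝒱 γ := by
  refine le_of_forall_pos_le_add fun ε hε => ?_
  obtain ⟨α, h1, h2, h3, h4⟩ := exists_entCondPart_le μ h𝒰 h𝒰m hβ hβm (half_pos hε)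
  obtain ⟨α', h1', h2', h3', h4'⟩ := exists_entCondPart_le μ h𝒱 h𝒱m hγ hγm (half_pos hε)
  have h5 := covEntCond_le_entCondPart μ (h1.join h1') (h2.join h2') (h3.join h3') (join β γ)
  have h6 := entCondPart_join_left_le μ h1 h2 h1' h2' (join β γ)
  have h7 := entCondPart_join_right_le μ hβ hβm hγ hγm α
  have h8 := entCondPart_join_right_le μ hγ hγm hβ hβm α'
  rw [join_comm γ β] at h8
  linarith

lemma covEntCond_pre_le (μ : Measure X) [IsProbabilityMeasure μ] {f : X → X}
    (hf : MeasurePreserving f μ μ) (hs : Function.Surjective f) {𝒰 β : Finset (Set X)}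
    (h𝒰 : IsCover 𝒰) (h𝒰m : MeasF 𝒰) (hβ : IsPartition β) (hβm : MeasF β) :
    covEntCond μ (pre f 𝒰) (pre f β) ≤ covEntCond μ 𝒰 β := by
  refine le_of_forall_pos_le_add fun ε hε => ?_
  obtain ⟨α, h1, h2, h3, h4⟩ := exists_entCondPart_le μ h𝒰 h𝒰m hβ hβm hε
  calc _ ≤ entCondPart μ (pre f α) (pre f β) :=
        covEntCond_le_entCondPart μ (h1.pre f) (h2.pre hf.measurable) (h3.pre f) _
    _ = entCondPart μ α β := entCondPart_pre μ hf hs h2 hβm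
    _ ≤ _ := h4

lemma subadditive_covEntCond (μ : Measure X) [IsProbabilityMeasure μ] {f : X → X}
    (hf : MeasurePreserving f μ μ) (hs : Function.Surjective f) {𝒰 β : Finset (Set X)}
    (h𝒰 : IsCover 𝒰) (h𝒰m : MeasF 𝒰) (hβ : IsPartition β) (hβm : MeasF β) :
    Subadditive fun n => covEntCond μ (dynJoin f 𝒰 n) (dynJoin f β n) := by
  intro m n
  have hm := hf.measurable
  have hU := h𝒰.dynJoin f
  have hUm := h𝒰m.dynJoin hm
  have hB := hβ.dynJoin f
  have hBm := hβm.dynJoin hm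
  simp only [dynJoin_add]
  refine (covEntCond_join_le μ (hU m) (hUm m) ((hU n).pre _) ((hUm n).pre (hm.iterate m))
    (hB m) (hBm m) ((hB n).pre _) ((hBm n).pre (hm.iterate m))).trans ?_
  gcongr
  exact covEntCond_pre_le μ (hf.iterate m) (hs.iterate m) (hU n) (hUm n) (hB n) (hBm n)

/-! ### Fekete's lemma -/

lemma _root_.Subadditive.bddBelow_of_nonneg {u : ℕ → ℝ} (h0 : ∀ n, 0 ≤ u n) :
    BddBelow (Set.range fun n => u n / n) :=
  ⟨0, by rintro _ ⟨n, rfl⟩; exact div_nonneg (h0 n) n.cast_nonneg⟩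

lemma _root_.Subadditive.iInf_succ_eq_lim {u : ℕ → ℝ} (hu : Subadditive u) :
    ⨅ n : ℕ, u (n + 1) / (n + 1 : ℝ) = hu.lim := by
  rw [Subadditive.lim, iInf]
  congr 1
  ext x
  constructor
  · rintro ⟨n, rfl⟩
    exact ⟨n + 1, by simp, by simp⟩
  · rintro ⟨n, hn, rfl⟩
    exact ⟨n - 1, by simp [Nat.sub_add_cancel (Set.mem_Ici.1 hn), Nat.cast_sub (Set.mem_Ici.1 hn)]⟩

lemma _root_.Subadditive.iInf_mul_succ_eq {u : ℕ → ℝ} (hu : Subadditive u) (h0 : ∀ n, 0 ≤ u n)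
    {m : ℕ} (hm : 0 < m) :
    ⨅ n : ℕ, u (m * (n + 1)) / (n + 1 : ℝ) = m * hu.lim := by
  have hv : Subadditive fun n => u (m * n) := fun a b => by
    simp only [mul_add]
    exact hu _ _
  rw [hv.iInf_succ_eq_lim]
  refine tendsto_nhds_unique
    (hv.tendsto_lim (Subadditive.bddBelow_of_nonneg fun n => h0 (m * n))) ?_
  have h := ((hu.tendsto_lim (Subadditive.bddBelow_of_nonneg h0)).comp
    (tendsto_id.const_mul_atTop' hm)).const_mul (m : ℝ)
  refine h.congr fun n => ?_
  have hm' : (m : ℝ) ≠ 0 := by positivity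
  simp only [Function.comp, id, Nat.cast_mul]
  rw [← mul_div_assoc, mul_div_mul_left _ _ hm']

lemma hMinus_eq_lim {f : X → X} {μ : Measure X} {𝒰 β : Finset (Set X)}
    (h : Subadditive fun n => covEntCond μ (dynJoin f 𝒰 n) (dynJoin f β n)) :
    hMinus f μ 𝒰 β = h.lim :=
  h.iInf_succ_eq_lim

lemma hMinus_iterate {f : X → X} {μ : Measure X} {𝒰 β : Finset (Set X)}
    (h : Subadditive fun n => covEntCond μ (dynJoin f 𝒰 n) (dynJoin f β n)) {m : ℕ} (hm : 0 < m) :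
    hMinus f^[m] μ (dynJoin f 𝒰 m) (dynJoin f β m) = m * hMinus f μ 𝒰 β := by
  rw [hMinus_eq_lim h, ← h.iInf_mul_succ_eq (fun n => covEntCond_nonneg μ _ _) hm]
  simp only [hMinus, dynJoin_iterate]

lemma hPart_le_entCondPart (f : X → X) (μ : Measure X) (α β : Finset (Set X)) :
    hPart f μ α β ≤ entCondPart μ α β := by
  have hbdd : BddBelow (Set.range fun n : ℕ =>
      entCondPart μ (dynJoin f α (n + 1)) (dynJoin f β (n + 1)) / (n + 1 : ℝ)) := by
    refine ⟨0, ?_⟩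
    rintro _ ⟨n, rfl⟩
    exact div_nonneg (entCondPart_nonneg μ _ _) (by positivity)
  simpa [hPart, dynJoin_one] using ciInf_le hbdd 0

lemma hMinus_le_hPart {f : X → X} (hf : Measurable f) (μ : Measure X) {𝒰 α : Finset (Set X)}
    (hα : IsPartition α) (hαm : MeasF α) (hα𝒰 : Refines α 𝒰) (β : Finset (Set X)) :
    hMinus f μ 𝒰 β ≤ hPart f μ α β := by
  refine ciInf_mono ⟨0, ?_⟩ fun n => ?_
  · rintro _ ⟨n, rfl⟩
    exact div_nonneg (covEntCond_nonneg μ _ _) (by positivity)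
  · gcongr
    exact covEntCond_le_entCondPart μ (hα.dynJoin f _) (hαm.dynJoin hf _) (hα𝒰.dynJoin f _) _

lemma hMinus_le_hPlus {f : X → X} (hf : Measurable f) (μ : Measure X) {𝒰 : Finset (Set X)}
    (h𝒰 : IsCover 𝒰) (h𝒰m : MeasF 𝒰) (β : Finset (Set X)) :
    hMinus f μ 𝒰 β ≤ hPlus f μ 𝒰 β := by
  obtain ⟨α, h1, h2, h3⟩ := exists_partition_refines h𝒰 h𝒰m
  refine le_csInf ⟨_, α, h1, h2, h3, rfl⟩ ?_
  rintro _ ⟨α, h1, h2, h3, rfl⟩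
  exact hMinus_le_hPart hf μ h1 h2 h3 β

lemma hPlus_le_covEntCond {f : X → X} (hf : Measurable f) (μ : Measure X)
    [IsProbabilityMeasure μ] {𝒰 β : Finset (Set X)} (h𝒰 : IsCover 𝒰) (h𝒰m : MeasF 𝒰)
    (hβ : IsPartition β) (hβm : MeasF β) :
    hPlus f μ 𝒰 β ≤ covEntCond μ 𝒰 β := by
  refine le_of_forall_pos_le_add fun ε hε => ?_
  obtain ⟨α, h1, h2, h3, h4⟩ := exists_entCondPart_le μ h𝒰 h𝒰m hβ hβm hε
  have hbdd : BddBelow {h : ℝ | ∃ α : Finset (Set X),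
      IsPartition α ∧ MeasF α ∧ Refines α 𝒰 ∧ h = hPart f μ α β} := by
    refine ⟨hMinus f μ 𝒰 β, ?_⟩
    rintro _ ⟨α, h1, h2, h3, rfl⟩
    exact hMinus_le_hPart hf μ h1 h2 h3 β
  exact (csInf_le hbdd ⟨α, h1, h2, h3, rfl⟩).trans ((hPart_le_entCondPart f μ α β).trans h4)

end Paper

open Paper MeasureTheory Real Filter

/-- For a TDS `(X,T)`, `μ ∈ M_T(X)`, a cover `𝒰` and a partition `β`:
for every `M ∈ ℕ`, `h⁻_μ(𝒰|β,T) = (1/M) h⁻_μ(𝒰_0^{M-1}|β_0^{M-1},T^M)`, and moreover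
`h⁻_μ(𝒰|β,T) = lim_{M→∞} (1/M) h⁺_μ(𝒰_0^{M-1}|β_0^{M-1},T^M)`. -/
theorem statement10 {X : Type*} [MetricSpace X] [CompactSpace X]
    [MeasurableSpace X] [BorelSpace X] (T : X ≃ₜ X)
    (μ : MeasureTheory.Measure X) [MeasureTheory.IsProbabilityMeasure μ]
    (hT : MeasureTheory.MeasurePreserving (⇑T) μ μ)
    (𝒰 β : Finset (Set X)) (h𝒰 : IsCover 𝒰) (h𝒰m : MeasF 𝒰)
    (hβ : IsPartition β) (hβm : MeasF β) :
    (∀ M : ℕ, 0 < M →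
      hMinus (⇑T) μ 𝒰 β =
        hMinus ((⇑T)^[M]) μ (dynJoin (⇑T) 𝒰 M) (dynJoin (⇑T) β M) / (M : ℝ)) ∧
    Filter.Tendsto
      (fun M : ℕ =>
        hPlus ((⇑T)^[M]) μ (dynJoin (⇑T) 𝒰 M) (dynJoin (⇑T) β M) / (M : ℝ))
      Filter.atTop (nhds (hMinus (⇑T) μ 𝒰 β)) := by
  have hsub := subadditive_covEntCond μ hT T.surjective h𝒰 h𝒰m hβ hβm
  refine ⟨fun M hM => ?_, ?_⟩
  · rw [hMinus_iterate hsub hM, mul_div_cancel_left₀ _ (by positivity)]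
  · have hlim := hsub.tendsto_lim
      (Subadditive.bddBelow_of_nonneg fun n => covEntCond_nonneg μ _ _)
    rw [← hMinus_eq_lim hsub] at hlim
    refine tendsto_of_tendsto_of_tendsto_of_le_of_le' tendsto_const_nhds hlim ?_ ?_
    · filter_upwards [eventually_gt_atTop 0] with M hM
      rw [le_div_iff₀ (by positivity), mul_comm, ← hMinus_iterate hsub hM]
      exact hMinus_le_hPlus (hT.measurable.iterate M) μ (h𝒰.dynJoin _ M)
        (h𝒰m.dynJoin hT.measurable M) _
    · refine Eventually.of_forall fun M => ?_
      exact div_le_div_of_nonneg_right (hPlus_le_covEntCond (hT.measurable.iterate M) μ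
        (h𝒰.dynJoin _ M) (h𝒰m.dynJoin hT.measurable M) (hβ.dynJoin _ M)
        (hβm.dynJoin hT.measurable M)) M.cast_nonneg
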